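/- arXiv:1712.06666 — 7 statements merged into one kernel-verified Lean document; each statement's English description precedes it below -/
import Mathlib

section
/- Fix L > 0, R > 0, H1 > 0 and 0 < α < β < 1. Then the leading-order anion flux J20(V) = (2·√(L·R)/H1) · (√(exp(−V)·L) − √R) / ((1−β)·√L + α·√(exp(−V)·R)) tends to 2L/(α·H1) as V → −∞. -/
open Real Filter

/-- For fixed `L > 0`, `R > 0`, `H1 > 0` and `0 < α < β < 1`, the
leading-order anion flux
`J20(V) = (2·√(L·R)/H1) · (√(exp(−V)·L) − √R) / ((1−β)·√L + α·√(exp(−V)·R))`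
tends to `2L/(α·H1)` as `V → −∞`. -/
theorem J20_tendsto_atBot (L R H1 α β : ℝ)
    (hL : 0 < L) (hR : 0 < R) (hH1 : 0 < H1)
    (hα : 0 < α) (hαβ : α < β) (hβ : β < 1) :
    Tendsto
      (fun V : ℝ =>
        (2 * Real.sqrt (L * R) / H1) *
          (Real.sqrt (Real.exp (-V) * L) - Real.sqrt R) /
            ((1 - β) * Real.sqrt L + α * Real.sqrt (Real.exp (-V) * R)))
      atBot (nhds (2 * L / (α * H1))) := by
  have hl : 0 < Real.sqrt L := Real.sqrt_pos.mpr hL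
  have hr : 0 < Real.sqrt R := Real.sqrt_pos.mpr hR
  have hLs : Real.sqrt L ^ 2 = L := Real.sq_sqrt hL.le
  have ht : Tendsto (fun V : ℝ => Real.exp (V / 2)) atBot (nhds 0) :=
    Real.tendsto_exp_atBot.comp (tendsto_id.atBot_div_const (by norm_num))
  have hc : ContinuousAt (fun t : ℝ => (2 * (Real.sqrt L * Real.sqrt R) / H1) *
      (Real.sqrt L - Real.sqrt R * t) /
        ((1 - β) * Real.sqrt L * t + α * Real.sqrt R)) 0 := by
    apply ContinuousAt.div
    · fun_prop
    · fun_prop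
    · have : 0 < α * Real.sqrt R := by positivity
      simpa using this.ne'
  have h := hc.tendsto.comp ht
  have e : 2 * L / (α * H1) = (2 * (Real.sqrt L * Real.sqrt R) / H1) *
      (Real.sqrt L - Real.sqrt R * 0) /
        ((1 - β) * Real.sqrt L * 0 + α * Real.sqrt R) := by
    rw [mul_zero, mul_zero, sub_zero, zero_add]
    field_simp
    linarith
  rw [e]
  refine h.congr fun V => ?_
  have hs : Real.sqrt (Real.exp (-V)) = (Real.exp (V / 2))⁻¹ := by
    rw [← Real.exp_half, ← Real.exp_neg, neg_div]
  have hp := Real.exp_pos (V / 2)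
  have h1 : 0 < 1 - β := by linarith
  simp only [Function.comp]
  rw [Real.sqrt_mul hL.le, Real.sqrt_mul (Real.exp_pos _).le,
    Real.sqrt_mul (Real.exp_pos _).le, hs]
  generalize Real.exp (V / 2) = t at hp
  generalize Real.sqrt L = l at *
  generalize Real.sqrt R = r at *
  have h2 : 0 < (1 - β) * l * t + α * r := by positivity
  have h3 : 0 < (1 - β) * l + α * (t⁻¹ * r) := by positivity
  rw [div_eq_div_iff h2.ne' h3.ne']
  field_simp
end

section
/- Fix L > 0, R > 0, H1 > 0 and 0 < α < β < 1. Then the first-order cation flux coefficient J11(V) = (1/(2·H1·(β−α))) · ( ((1−β)·L + α·R) / ((1−β)·√(exp(V)·L) + α·√R) )² · (exp(V)·L − R) tends to ((1−β)·L + α·R)² / (2·H1·(β−α)·(1−β)²) as V → +∞. -/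
open Real Filter

/-- For fixed `L > 0`, `R > 0`, `H1 > 0` and `0 < α < β < 1`, the
first-order cation flux coefficient
`J11(V) = (1/(2·H1·(β−α))) · (((1−β)·L + α·R)/((1−β)·√(exp(V)·L) + α·√R))² · (exp(V)·L − R)`
tends to `((1−β)·L + α·R)² / (2·H1·(β−α)·(1−β)²)` as `V → +∞`. -/
theorem J11_tendsto_atTop (L R H1 α β : ℝ)
    (hL : 0 < L) (hR : 0 < R) (hH1 : 0 < H1)
    (hα : 0 < α) (hαβ : α < β) (hβ : β < 1) :
    Tendsto
      (fun V : ℝ =>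
        (1 / (2 * H1 * (β - α))) *
          (((1 - β) * L + α * R) /
            ((1 - β) * Real.sqrt (Real.exp V * L) + α * Real.sqrt R)) ^ 2 *
          (Real.exp V * L - R))
      atTop
      (nhds (((1 - β) * L + α * R) ^ 2 / (2 * H1 * (β - α) * (1 - β) ^ 2))) := by
  have hb : 0 < 1 - β := by linarith
  have hc : 0 < β - α := by linarith
  have hs : Tendsto (fun V : ℝ => (Real.sqrt (Real.exp V * L))⁻¹) atTop (nhds 0) :=
    (Real.tendsto_sqrt_atTop.comp
      (Real.tendsto_exp_atTop.atTop_mul_const hL)).inv_tendsto_atTop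
  have hcont : ContinuousAt (fun t : ℝ => (1 / (2 * H1 * (β - α))) *
      (((1 - β) * L + α * R) / ((1 - β) + α * Real.sqrt R * t)) ^ 2 * (1 - R * t ^ 2)) 0 := by
    have h0 : (1 - β) + α * Real.sqrt R * 0 ≠ 0 := by simpa using hb.ne'
    fun_prop (disch := assumption)
  have h := hcont.tendsto.comp hs
  have hv : (1 / (2 * H1 * (β - α))) *
      (((1 - β) * L + α * R) / ((1 - β) + α * Real.sqrt R * 0)) ^ 2 * (1 - R * 0 ^ 2)
      = ((1 - β) * L + α * R) ^ 2 / (2 * H1 * (β - α) * (1 - β) ^ 2) := by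
    have := hb.ne'
    have := hc.ne'
    simp only [mul_zero, add_zero]
    field_simp
    ring
  rw [hv] at h
  refine h.congr fun V => ?_
  have hx : 0 < Real.exp V * L := by positivity
  have hs0 : 0 < Real.sqrt (Real.exp V * L) := Real.sqrt_pos.mpr hx
  have hsq := Real.sq_sqrt hx.le
  simp only [Function.comp]
  generalize Real.sqrt (Real.exp V * L) = s at *
  rw [← hsq]
  have hr : 0 < α * Real.sqrt R := by positivity
  generalize α * Real.sqrt R = r at *
  have e1 : (1 - β) + r * s⁻¹ = ((1 - β) * s + r) / s := by field_simp
  have e2 : 1 - R * s⁻¹ ^ 2 = (s ^ 2 - R) / s ^ 2 := by field_simp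
  have hd : 0 < (1 - β) * s + r := by positivity
  rw [e1, e2]
  generalize (1 - β) * s + r = d at *
  have := hc.ne'
  field_simp
end

section
/- Fix L > 0, R > 0, H1 > 0 and 0 < α < β < 1. Then the first-order anion flux coefficient J21(V) tends to −((1−β)·L + α·R)² / (2·H1·(β−α)·(1−β)²) as V → +∞, where J21(V) = ((1−β)·L + α·R) / (2·H1·(β−α)·(√(exp(−V)·L) − √R)·((1−β)·√L + α·√(exp(−V)·R))³) · { −2·(β−α)²·(√(exp(−V)·L) − √R)²·√(exp(−V))·L·R + ((1−β)·L + α·R)·(L − R·exp(−V))·[ (((1−β)·L + α·R)/2)·√(exp(−V))·ln(L/(exp(V)·R)) − ((1−β)·√L + α·√(exp(−V)·R))·(√(exp(−V)·L) − √R) ] }. -/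
open Real Filter

/-- For fixed `L > 0`, `R > 0`, `H1 > 0` and `0 < α < β < 1`, the
first-order anion flux coefficient `J21(V)` (given by the explicit formula below)
tends to `−((1−β)·L + α·R)² / (2·H1·(β−α)·(1−β)²)` as `V → +∞`. -/
theorem J21_tendsto_atTop (L R H1 α β : ℝ)
    (hL : 0 < L) (hR : 0 < R) (hH1 : 0 < H1)
    (hα : 0 < α) (hαβ : α < β) (hβ : β < 1) :
    Tendsto
      (fun V : ℝ =>
        ((1 - β) * L + α * R) /
            (2 * H1 * (β - α) * (Real.sqrt (Real.exp (-V) * L) - Real.sqrt R) *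
              ((1 - β) * Real.sqrt L + α * Real.sqrt (Real.exp (-V) * R)) ^ 3) *
          (-2 * (β - α) ^ 2 * (Real.sqrt (Real.exp (-V) * L) - Real.sqrt R) ^ 2 *
              Real.sqrt (Real.exp (-V)) * L * R +
            ((1 - β) * L + α * R) * (L - R * Real.exp (-V)) *
              ((((1 - β) * L + α * R) / 2) * Real.sqrt (Real.exp (-V)) *
                  Real.log (L / (Real.exp V * R)) -
                ((1 - β) * Real.sqrt L + α * Real.sqrt (Real.exp (-V) * R)) *
                  (Real.sqrt (Real.exp (-V) * L) - Real.sqrt R))))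
      atTop
      (nhds (-(((1 - β) * L + α * R) ^ 2) / (2 * H1 * (β - α) * (1 - β) ^ 2))) := by
  have hs : Tendsto (fun V : ℝ => Real.exp (-V / 2)) atTop (nhds 0) := by
    refine Real.tendsto_exp_atBot.comp ?_
    have h : Tendsto (fun V : ℝ => V * (-1 / 2)) atTop atBot :=
      tendsto_id.atTop_mul_const_of_neg (by norm_num)
    refine h.congr fun V => by ring
  have ht : Tendsto (fun V : ℝ => Real.exp (-V / 2) * V) atTop (nhds 0) := by
    have h1 : Tendsto (fun V : ℝ => V * (1 / 2)) atTop atTop :=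
      tendsto_id.atTop_mul_const (by norm_num)
    have h2 := ((Real.tendsto_pow_mul_exp_neg_atTop_nhds_zero 1).comp h1).const_mul 2
    rw [mul_zero] at h2
    refine h2.congr fun V => ?_
    simp only [Function.comp, pow_one]
    rw [show -(V * (1 / 2)) = -V / 2 by ring]
    ring
  have hsL : 0 < √L := Real.sqrt_pos.2 hL
  have hsR : 0 < √R := Real.sqrt_pos.2 hR
  have hβ1 : 0 < 1 - β := by linarith
  have hβα : 0 < β - α := by linarith
  have hc : ContinuousAt (fun p : ℝ × ℝ =>
      ((1 - β) * L + α * R) /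
            (2 * H1 * (β - α) * (p.1 * √L - √R) * ((1 - β) * √L + α * (p.1 * √R)) ^ 3) *
          (-2 * (β - α) ^ 2 * (p.1 * √L - √R) ^ 2 * p.1 * L * R +
            ((1 - β) * L + α * R) * (L - R * p.1 ^ 2) *
              ((((1 - β) * L + α * R) / 2) * (p.1 * Real.log (L / R) - p.2) -
                ((1 - β) * √L + α * (p.1 * √R)) * (p.1 * √L - √R)))) (0, 0) := by
    refine ContinuousAt.mul (ContinuousAt.div (by fun_prop) (by fun_prop) ?_) (by fun_prop)
    have : (0:ℝ) - √R ≠ 0 := by linarith [hsR] |> fun h : 0 - √R < 0 => h.ne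
    simp only [zero_mul, mul_zero, add_zero]
    positivity
  have hlim := hc.tendsto.comp (hs.prodMk_nhds ht)
  have hval : ∀ a b : ℝ, a = b → nhds a = nhds b := fun a b h => by rw [h]
  convert hlim using 1
  · funext V
    have he : Real.exp (-V) = Real.exp (-V / 2) ^ 2 := by
      rw [← Real.exp_nat_mul]; congr 1; push_cast; ring
    have hq : √(Real.exp (-V)) = Real.exp (-V / 2) := by
      rw [he, Real.sqrt_sq (Real.exp_pos _).le]
    have hl : Real.log (L / (Real.exp V * R)) = Real.log (L / R) - V := by
      rw [Real.log_div hL.ne' (by positivity), Real.log_mul (by positivity) hR.ne',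
        Real.log_exp, Real.log_div hL.ne' hR.ne']
      ring
    simp only [Function.comp]
    rw [Real.sqrt_mul (Real.exp_pos _).le, Real.sqrt_mul (Real.exp_pos _).le, hq, hl, he]
    ring
  · apply hval
    obtain ⟨a, ha⟩ : ∃ a, a = √L := ⟨_, rfl⟩
    obtain ⟨b, hb⟩ : ∃ b, b = √R := ⟨_, rfl⟩
    have hLa : L = a ^ 2 := by rw [ha, Real.sq_sqrt hL.le]
    simp only [← ha, ← hb] at *
    simp only [zero_mul, mul_zero, add_zero, zero_sub, sub_zero]
    generalize hA : (1 - β) * L + α * R = A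
    rw [hLa]
    field_simp
    ring
end

section
/- Fix L > 0, R > 0, H1 > 0 and 0 < α < β < 1. Then the first-order anion flux coefficient J21(V) tends to ((1−β)·L + α·R)² / (2·H1·(β−α)·α²) as V → −∞, where J21(V) = ((1−β)·L + α·R) / (2·H1·(β−α)·(√(exp(−V)·L) − √R)·((1−β)·√L + α·√(exp(−V)·R))³) · { −2·(β−α)²·(√(exp(−V)·L) − √R)²·√(exp(−V))·L·R + ((1−β)·L + α·R)·(L − R·exp(−V))·[ (((1−β)·L + α·R)/2)·√(exp(−V))·ln(L/(exp(V)·R)) − ((1−β)·√L + α·√(exp(−V)·R))·(√(exp(−V)·L) − √R) ] }. -/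
open Real Filter

/-- For fixed `L > 0`, `R > 0`, `H1 > 0` and `0 < α < β < 1`, the
first-order anion flux coefficient `J21(V)` (given by the explicit formula below)
tends to `((1−β)·L + α·R)² / (2·H1·(β−α)·α²)` as `V → −∞`. -/
theorem J21_tendsto_atBot (L R H1 α β : ℝ)
    (hL : 0 < L) (hR : 0 < R) (hH1 : 0 < H1)
    (hα : 0 < α) (hαβ : α < β) (hβ : β < 1) :
    Tendsto
      (fun V : ℝ =>
        ((1 - β) * L + α * R) /
            (2 * H1 * (β - α) * (Real.sqrt (Real.exp (-V) * L) - Real.sqrt R) *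
              ((1 - β) * Real.sqrt L + α * Real.sqrt (Real.exp (-V) * R)) ^ 3) *
          (-2 * (β - α) ^ 2 * (Real.sqrt (Real.exp (-V) * L) - Real.sqrt R) ^ 2 *
              Real.sqrt (Real.exp (-V)) * L * R +
            ((1 - β) * L + α * R) * (L - R * Real.exp (-V)) *
              ((((1 - β) * L + α * R) / 2) * Real.sqrt (Real.exp (-V)) *
                  Real.log (L / (Real.exp V * R)) -
                ((1 - β) * Real.sqrt L + α * Real.sqrt (Real.exp (-V) * R)) *
                  (Real.sqrt (Real.exp (-V) * L) - Real.sqrt R))))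
      atBot
      (nhds (((1 - β) * L + α * R) ^ 2 / (2 * H1 * (β - α) * α ^ 2))) := by
  obtain ⟨s, hs, rfl⟩ : ∃ s : ℝ, 0 < s ∧ L = s ^ 2 :=
    ⟨Real.sqrt L, Real.sqrt_pos.2 hL, (Real.sq_sqrt hL.le).symm⟩
  obtain ⟨r, hr, rfl⟩ : ∃ r : ℝ, 0 < r ∧ R = r ^ 2 :=
    ⟨Real.sqrt R, Real.sqrt_pos.2 hR, (Real.sq_sqrt hR.le).symm⟩
  have hba : β - α ≠ 0 := by linarith
  have hH : H1 ≠ 0 := hH1.ne'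
  set M := (1 - β) * s ^ 2 + α * r ^ 2 with hM
  let g : ℝ → ℝ := fun y =>
    M / (2 * H1 * (β - α) * (s - r * y) * ((1 - β) * s * y + α * r) ^ 3) *
      (-2 * (β - α) ^ 2 * (s - r * y) ^ 2 * y * s ^ 2 * r ^ 2 +
        M * (s ^ 2 * y ^ 2 - r ^ 2) *
          (M / 2 * (y * Real.log (s ^ 2 / r ^ 2) - 2 * (y * Real.log y)) -
            ((1 - β) * s * y + α * r) * (s - r * y)))
  have hg : ContinuousAt g 0 := by
    have h1 : ContinuousAt (fun y : ℝ => y * Real.log y) 0 :=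
      Real.continuous_mul_log.continuousAt
    have h2 : 2 * H1 * (β - α) * (s - r * 0) * ((1 - β) * s * 0 + α * r) ^ 3 ≠ 0 := by
      simp [hba, hH, hs.ne', hr.ne', hα.ne']
    refine ContinuousAt.mul (ContinuousAt.div (by fun_prop) (by fun_prop) h2) ?_
    refine ContinuousAt.add (by fun_prop) (ContinuousAt.mul (by fun_prop) ?_)
    refine ContinuousAt.sub (ContinuousAt.mul (by fun_prop) ?_) (by fun_prop)
    exact ContinuousAt.sub (by fun_prop) (continuousAt_const.mul h1)
  have hg0 : g 0 = M ^ 2 / (2 * H1 * (β - α) * α ^ 2) := by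
    have := hs.ne'
    have := hr.ne'
    have := hα.ne'
    simp only [g]
    simp only [mul_zero, zero_mul, sub_zero, zero_add]
    field_simp
    ring
  have hy : Tendsto (fun V : ℝ => Real.exp (V / 2)) atBot (nhds 0) :=
    Real.tendsto_exp_atBot.comp (tendsto_id.atBot_div_const (by norm_num))
  have key := hg.tendsto.comp hy
  rw [hg0] at key
  refine key.congr fun V => ?_
  have hlog : Real.log (s ^ 2 / (Real.exp V * r ^ 2)) =
      Real.log (s ^ 2 / r ^ 2) - 2 * Real.log (Real.exp (V / 2)) := by
    rw [Real.log_exp, Real.log_div (by positivity) (by positivity),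
      Real.log_div (by positivity) (by positivity), Real.log_mul (by positivity) (by positivity),
      Real.log_exp]
    ring
  have hexp : Real.exp (-V) = (1 / Real.exp (V / 2)) ^ 2 := by
    rw [one_div, ← Real.exp_neg, sq, ← Real.exp_add]
    congr 1
    ring
  rw [hlog, hexp]
  have hypos := Real.exp_pos (V / 2)
  simp only [Function.comp, g]
  generalize Real.exp (V / 2) = y at hypos
  have hyi : 0 < 1 / y := by positivity
  rw [← mul_pow (1 / y) s, ← mul_pow (1 / y) r, Real.sqrt_sq hyi.le,
    Real.sqrt_sq (mul_pos hyi hs).le, Real.sqrt_sq (mul_pos hyi hr).le, Real.sqrt_sq hs.le, Real.sqrt_sq hr.le]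
  generalize Real.log (s ^ 2 / r ^ 2) = A
  generalize Real.log y = B
  clear_value M
  have e1 : 1 / y * s - r = (s - r * y) / y := by field_simp
  have e2 : (1 - β) * s + α * (1 / y * r) = ((1 - β) * s * y + α * r) / y := by field_simp
  have e3 : s ^ 2 - r ^ 2 * (1 / y) ^ 2 = (s ^ 2 * y ^ 2 - r ^ 2) / y ^ 2 := by field_simp
  rw [e1, e2, e3]
  generalize s - r * y = P
  generalize (1 - β) * s * y + α * r = Q
  generalize s ^ 2 * y ^ 2 - r ^ 2 = T
  have e4 : 2 * H1 * (β - α) * (P / y) * (Q / y) ^ 3 =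
      (2 * H1 * (β - α) * P * Q ^ 3) / y ^ 4 := by field_simp
  rw [e4]
  generalize 2 * H1 * (β - α) * P * Q ^ 3 = D
  have e5 : M / (D / y ^ 4) = M / D * y ^ 4 := by
    rw [div_div_eq_mul_div, mul_div_right_comm]
  rw [e5, mul_assoc (M / D) (y ^ 4)]
  congr 1
  field_simp
end

section
/- Fix V ∈ ℝ, L > 0, H1 > 0 and 0 < α < β < 1, and define g(w) = (2·√L/H1) · (√(exp(−V)·L)·w − w²) / ((1−β)·√L + α·√(exp(−V))·w) for w ≥ 0. Then there exists w0 > 0 such that g is strictly monotonically increasing on the interval [0, w0]; consequently, as w decreases to 0 through (0, w0], g(w) decreases strictly monotonically to g(0) = 0, and g(w) > 0 for all w ∈ (0, w0]. -/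
open Real Filter Set

theorem g_aux (c A d e : ℝ) (hc : 0 < c) (hA : 0 < A) (hd : 0 < d) (he : 0 < e) :
    ∃ w0 : ℝ, 0 < w0 ∧
      StrictMonoOn (fun w : ℝ => c * (A * w - w ^ 2) / (d + e * w)) (Set.Icc 0 w0) ∧
      c * (A * 0 - 0 ^ 2) / (d + e * 0) = 0 ∧
      ∀ w ∈ Set.Ioc (0 : ℝ) w0, 0 < c * (A * w - w ^ 2) / (d + e * w) := by
  refine ⟨min (A / 4) (d / e), by positivity, ?_, by simp, ?_⟩
  · rintro x ⟨hx0, hx⟩ y ⟨hy0, hy⟩ hxy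
    have hxA := hx.trans (min_le_left _ _)
    have hyA := hy.trans (min_le_left _ _)
    have hyd := hy.trans (min_le_right _ _)
    rw [le_div_iff₀ he] at hyd
    have h1 : 0 < d + e * x := by positivity
    have h2 : 0 < d + e * y := by positivity
    have h3 : x * (y * e) ≤ A / 4 * d :=
      mul_le_mul hxA hyd (by positivity) (by positivity)
    have h4 : d * (x + y) ≤ d * (A / 2) :=
      mul_le_mul_of_nonneg_left (by linarith) hd.le
    have h5 : 0 < A * d - d * (x + y) - x * (y * e) := by
      have := mul_pos hA hd
      linarith
    have h6 := mul_pos hc (mul_pos (sub_pos.2 hxy) h5)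
    show c * (A * x - x ^ 2) / (d + e * x) < c * (A * y - y ^ 2) / (d + e * y)
    rw [div_lt_div_iff₀ h1 h2]
    linarith
  · rintro w ⟨hw0, hw⟩
    have hwA := hw.trans (min_le_left _ _)
    have h : 0 < A * w - w ^ 2 := by
      have := mul_pos hw0 (show 0 < A - w by linarith)
      linarith
    positivity

/-- For fixed `V`, `L > 0`, `H1 > 0` and `0 < α < β < 1`, and
`g(w) = (2·√L/H1) · (√(exp(−V)·L)·w − w²) / ((1−β)·√L + α·√(exp(−V))·w)`,
there exists `w0 > 0` such that `g` is strictly increasing on `[0, w0]`;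
moreover `g(0) = 0` and `g(w) > 0` for all `w ∈ (0, w0]`. -/
theorem g_strictMonoOn_near_zero (V L H1 α β : ℝ)
    (hL : 0 < L) (hH1 : 0 < H1)
    (hα : 0 < α) (hαβ : α < β) (hβ : β < 1) :
    ∃ w0 : ℝ, 0 < w0 ∧
      StrictMonoOn
        (fun w : ℝ =>
          (2 * Real.sqrt L / H1) *
            (Real.sqrt (Real.exp (-V) * L) * w - w ^ 2) /
              ((1 - β) * Real.sqrt L + α * Real.sqrt (Real.exp (-V)) * w))
        (Set.Icc 0 w0) ∧
      (2 * Real.sqrt L / H1) *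
          (Real.sqrt (Real.exp (-V) * L) * 0 - 0 ^ 2) /
            ((1 - β) * Real.sqrt L + α * Real.sqrt (Real.exp (-V)) * 0) = 0 ∧
      ∀ w ∈ Set.Ioc (0 : ℝ) w0,
        0 < (2 * Real.sqrt L / H1) *
              (Real.sqrt (Real.exp (-V) * L) * w - w ^ 2) /
                ((1 - β) * Real.sqrt L + α * Real.sqrt (Real.exp (-V)) * w) := by
  have hs : 0 < Real.sqrt L := Real.sqrt_pos.2 hL
  have hb : 0 < 1 - β := by linarith
  have hE := Real.exp_pos (-V)
  exact g_aux _ _ _ _ (by positivity) (by positivity) (by positivity) (by positivity)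
end

section
/- Fix V ∈ ℝ, L > 0, H1 > 0 and 0 < α < β < 1. Then there exists R0 > 0 such that the leading-order anion flux R ↦ J20(R) = (2·√(L·R)/H1) · (√(exp(−V)·L) − √R) / ((1−β)·√L + α·√(exp(−V)·R)) is strictly concave on the interval (0, R0). -/
open Real Filter Set

theorem aux_concave (a b c e : ℝ) (ha : 0 < a) (hb : 0 < b) (hc : 0 < c) (he : 0 < e) :
    ∃ R0 : ℝ, 0 < R0 ∧ StrictConcaveOn ℝ (Set.Ioo (0 : ℝ) R0)
      (fun R : ℝ => c * √R * (e - √R) / (b + a * √R)) := by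
  have hs0 : 0 < min (e / 3) (b / a) := by positivity
  refine ⟨(min (e / 3) (b / a)) ^ 2, by positivity, ?_⟩
  have hD : ∀ x : ℝ, 0 < x → HasDerivAt (fun R : ℝ => c * √R * (e - √R) / (b + a * √R))
      (c / 2 * ((e * b / √x - 2 * b - a * √x) / (b + a * √x) ^ 2)) x := by
    intro x hx
    have hs : 0 < √x := Real.sqrt_pos.2 hx
    have h1 := Real.hasDerivAt_sqrt hx.ne'
    have hne : b + a * √x ≠ 0 := by positivity
    have h2 := ((h1.const_mul c).mul (h1.const_sub e)).div ((h1.const_mul a).const_add b) hne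
    refine h2.congr_deriv ?_
    simp only [Pi.mul_apply]
    field_simp
    ring
  apply StrictAntiOn.strictConcaveOn_of_deriv (convex_Ioo _ _)
  · intro x hx
    exact (hD x hx.1).continuousAt.continuousWithinAt
  · rw [interior_Ioo]
    intro x hx y hy hxy
    rw [(hD x hx.1).deriv, (hD y hy.1).deriv]
    have hs : 0 < √x := Real.sqrt_pos.2 hx.1
    have hst : √x < √y := Real.sqrt_lt_sqrt hx.1.le hxy
    have ht0 : √y < min (e / 3) (b / a) := (Real.sqrt_lt' hs0).2 hy.2
    have ht1 := (lt_min_iff.1 ht0).1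
    have ht2 := (lt_min_iff.1 ht0).2
    generalize √x = s at *
    generalize √y = t at *
    have ht : 0 < t := hs.trans hst
    have hat : a * t < b := by rw [lt_div_iff₀ ha] at ht2; linarith
    have h3 : 3 * b < e * b / t := by
      rw [lt_div_iff₀ ht]; nlinarith
    have h4 : e * b / t < e * b / s := by gcongr
    have h5 : a * s < a * t := by gcongr
    apply mul_lt_mul_of_pos_left _ (by positivity)
    apply div_lt_div₀ (by linarith) (by gcongr) (by linarith) (by positivity)

/-- For fixed `V`, `L > 0`, `H1 > 0` and `0 < α < β < 1`, there exists
`R0 > 0` such that the leading-order anion flux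
`R ↦ J20(R) = (2·√(L·R)/H1) · (√(exp(−V)·L) − √R) / ((1−β)·√L + α·√(exp(−V)·R))`
is strictly concave on `(0, R0)`. -/
theorem J20_strictConcaveOn (V L H1 α β : ℝ)
    (hL : 0 < L) (hH1 : 0 < H1)
    (hα : 0 < α) (hαβ : α < β) (hβ : β < 1) :
    ∃ R0 : ℝ, 0 < R0 ∧
      StrictConcaveOn ℝ (Set.Ioo (0 : ℝ) R0)
        (fun R : ℝ =>
          (2 * Real.sqrt (L * R) / H1) *
            (Real.sqrt (Real.exp (-V) * L) - Real.sqrt R) /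
              ((1 - β) * Real.sqrt L + α * Real.sqrt (Real.exp (-V) * R))) := by
  have hb : 0 < (1 - β) * √L := mul_pos (by linarith) (Real.sqrt_pos.2 hL)
  have hE := Real.exp_pos (-V)
  obtain ⟨R0, h0, h⟩ := aux_concave (α * √(Real.exp (-V))) ((1 - β) * √L) (2 * √L / H1)
    (√(Real.exp (-V) * L)) (by positivity) hb (by positivity) (by positivity)
  refine ⟨R0, h0, ?_⟩
  convert h using 2 with R
  rw [Real.sqrt_mul hL.le, Real.sqrt_mul hE.le R]
  ring
end

section
/- Fix V ∈ ℝ, L > 0, H1 > 0 and 0 < α < β < 1, and define g(w) = (2·√L/H1) · (√(exp(−V)·L)·w − w²) / ((1−β)·√L + α·√(exp(−V))·w) for w ≥ 0. Let w0 > 0 be the unique positive root of the quadratic equation α·√(exp(−V))·w² + 2·(1−β)·√L·w − (1−β)·√L·√(exp(−V)·L) = 0. Then for every w with 0 < w < w0 the derivative of g at w is strictly positive, and for every w > w0 the derivative of g at w is strictly negative. -/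
open Real Filter

theorem g_deriv_aux (k A B c w0 w : ℝ) (hA : 0 < A) (hB : 0 < B) (hw : 0 < w)
    (hr : B * w0 ^ 2 + 2 * A * w0 - A * c = 0) :
    deriv (fun w : ℝ => k * (c * w - w ^ 2) / (A + B * w)) w =
      k * (w0 - w) * ((B * (w0 + w) + 2 * A) / (A + B * w) ^ 2) := by
  have hD : A + B * w ≠ 0 := by positivity
  have h1 : HasDerivAt (fun w : ℝ => k * (c * w - w ^ 2)) (k * (c * 1 - 2 * w)) w := by
    have h := (((hasDerivAt_id w).const_mul c).sub (hasDerivAt_pow 2 w)).const_mul k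
    simpa using h
  have h2 : HasDerivAt (fun w : ℝ => A + B * w) (B * 1) w :=
    ((hasDerivAt_id w).const_mul B).const_add A
  have h3 := (h1.div h2 hD).deriv
  refine Eq.trans h3 ?_
  field_simp
  linear_combination (-k) * hr

/-- For fixed `V`, `L > 0`, `H1 > 0` and `0 < α < β < 1`, let
`g(w) = (2·√L/H1) · (√(exp(−V)·L)·w − w²) / ((1−β)·√L + α·√(exp(−V))·w)` and let
`w0 > 0` be the unique positive root of
`α·√(exp(−V))·w² + 2·(1−β)·√L·w − (1−β)·√L·√(exp(−V)·L) = 0`.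
Then the derivative of `g` is strictly positive on `(0, w0)` and strictly negative
on `(w0, ∞)`. -/
theorem g_deriv_sign (V L H1 α β w0 : ℝ)
    (hL : 0 < L) (hH1 : 0 < H1)
    (hα : 0 < α) (hαβ : α < β) (hβ : β < 1)
    (hw0 : 0 < w0)
    (hroot : α * Real.sqrt (Real.exp (-V)) * w0 ^ 2 +
        2 * (1 - β) * Real.sqrt L * w0 -
        (1 - β) * Real.sqrt L * Real.sqrt (Real.exp (-V) * L) = 0) :
    (∀ w : ℝ, 0 < w → w < w0 →
      0 < deriv
        (fun w : ℝ =>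
          (2 * Real.sqrt L / H1) *
            (Real.sqrt (Real.exp (-V) * L) * w - w ^ 2) /
              ((1 - β) * Real.sqrt L + α * Real.sqrt (Real.exp (-V)) * w)) w) ∧
    (∀ w : ℝ, w0 < w →
      deriv
        (fun w : ℝ =>
          (2 * Real.sqrt L / H1) *
            (Real.sqrt (Real.exp (-V) * L) * w - w ^ 2) /
              ((1 - β) * Real.sqrt L + α * Real.sqrt (Real.exp (-V)) * w)) w < 0) := by
  have hA : 0 < (1 - β) * Real.sqrt L := mul_pos (by linarith) (Real.sqrt_pos.mpr hL)
  have hB : 0 < α * Real.sqrt (Real.exp (-V)) :=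
    mul_pos hα (Real.sqrt_pos.mpr (Real.exp_pos _))
  have hk : 0 < 2 * Real.sqrt L / H1 := by positivity
  have hr : α * Real.sqrt (Real.exp (-V)) * w0 ^ 2 + 2 * ((1 - β) * Real.sqrt L) * w0 -
      ((1 - β) * Real.sqrt L) * Real.sqrt (Real.exp (-V) * L) = 0 := by linarith
  constructor
  · intro w hw hlt
    rw [g_deriv_aux _ _ _ _ _ w hA hB hw hr]
    have h1 : 0 < w0 - w := by linarith
    positivity
  · intro w hlt
    have hw : 0 < w := by linarith
    rw [g_deriv_aux _ _ _ _ _ w hA hB hw hr]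
    have h1 : 0 < w - w0 := by linarith
    rw [← neg_sub w w0, mul_neg, neg_mul]
    rw [neg_lt_zero]
    positivity
end
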